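/- arXiv:0706.3500 — 4 statements merged into one kernel-verified Lean document; each statement's English description precedes it below -/
import Mathlib

section
/- Suppose the high temperature condition holds with parameters q ∈ [0,1) and K > 0, and let v₁,…,v_N, w₁,…,w_N be arbitrary bounded functions of the disorder g and the configuration σ. Then there exists a constant C depending only on β, h, K such that E( (1/N²) Σ_{j,k=1}^N ⟨σ̇_j v_k⟩ ⟨w_k σ_j⟩ ) ≤ (C/N^{3/2}) Σ_{k=1}^N ( E ⟨v_k²⟩ ⟨w_k²⟩ )^{1/2}. -/
open MeasureTheory ProbabilityTheory Real Finset

namespace SK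

/-- Index set of pairs `i < j` in `Fin N`. -/
abbrev Pairs (N : ℕ) := {p : Fin N × Fin N // p.1 < p.2}

/-- The disorder: one real coordinate per pair. -/
abbrev Disorder (N : ℕ) := Pairs N → ℝ

/-- Law of the disorder: i.i.d. standard Gaussians. -/
noncomputable def μdis (N : ℕ) : Measure (Disorder N) :=
  Measure.pi fun _ => gaussianReal 0 1

/-- The symmetric extension `g_{ij}` of the disorder. -/
noncomputable def gval {N : ℕ} (G : Disorder N) (i j : Fin N) : ℝ :=
  if hij : i < j then G ⟨(i, j), hij⟩ else if hji : j < i then G ⟨(j, i), hji⟩ else 0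

abbrev Config (N : ℕ) := Fin N → Bool

/-- Spins `±1`. -/
def spin (b : Bool) : ℝ := if b then 1 else -1

/-- (Negative) Hamiltonian of the SK model. -/
noncomputable def ham {N : ℕ} (β h : ℝ) (G : Disorder N) (σ : Config N) : ℝ :=
  (β / Real.sqrt N) * ∑ p : Pairs N, G p * spin (σ p.1.1) * spin (σ p.1.2)
    + h * ∑ i, spin (σ i)

/-- Partition function. -/
noncomputable def Zpart {N : ℕ} (β h : ℝ) (G : Disorder N) : ℝ :=
  ∑ σ : Config N, Real.exp (ham β h G σ)

/-- Gibbs measure. -/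
noncomputable def gibbs {N : ℕ} (β h : ℝ) (G : Disorder N) (σ : Config N) : ℝ :=
  Real.exp (ham β h G σ) / Zpart β h G

/-- Quenched average of a function of one replica. -/
noncomputable def qavg {N : ℕ} (β h : ℝ) (G : Disorder N) (f : Config N → ℝ) : ℝ :=
  ∑ σ : Config N, f σ * gibbs β h G σ

/-- Quenched average of a function of two replicas. -/
noncomputable def qavg2 {N : ℕ} (β h : ℝ) (G : Disorder N)
    (f : Config N → Config N → ℝ) : ℝ :=
  ∑ σ1 : Config N, ∑ σ2 : Config N, f σ1 σ2 * gibbs β h G σ1 * gibbs β h G σ2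

/-- Overlap of two configurations. -/
noncomputable def overlap {N : ℕ} (σ1 σ2 : Config N) : ℝ :=
  (1 / (N : ℝ)) * ∑ i, spin (σ1 i) * spin (σ2 i)

/-- The high temperature condition `E⟨(R₁₂ - q)⁴⟩ ≤ K/N²`. -/
def highTemp (N : ℕ) (β h q K : ℝ) : Prop :=
  ∫ G, qavg2 β h G (fun σ1 σ2 => (overlap σ1 σ2 - q) ^ 4) ∂(μdis N) ≤ K / (N : ℝ) ^ 2

/-- Magnetization `⟨σ_i⟩`. -/
noncomputable def mavg {N : ℕ} (β h : ℝ) (G : Disorder N) (i : Fin N) : ℝ :=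
  qavg β h G fun σ => spin (σ i)

/-- Local field `ℓ_i`. -/
noncomputable def locField {N : ℕ} (G : Disorder N) (i : Fin N) (σ : Config N) : ℝ :=
  (1 / Real.sqrt N) * ∑ j ∈ Finset.univ.erase i, gval G i j * spin (σ j)

/-- The field `r_i`. -/
noncomputable def rfield {N : ℕ} (β h q : ℝ) (G : Disorder N) (i : Fin N) : ℝ :=
  (1 / Real.sqrt N) * ∑ j ∈ Finset.univ.erase i, gval G i j * mavg β h G j
    - β * (1 - q) * mavg β h G i

/-- Gaussian density `φ_{μ,v}` with mean `μ` and variance `v`. -/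
noncomputable def gaussDens (μ v x : ℝ) : ℝ :=
  (1 / (Real.sqrt (2 * π) * Real.sqrt v)) * Real.exp (-(x - μ) ^ 2 / (2 * v))

/-- Mixture-Gaussian density `ψ_{a,b,μ,v}`. -/
noncomputable def mixDens (a b μ v x : ℝ) : ℝ :=
  Real.cosh (a * x + b) * Real.exp (-(x - μ) ^ 2 / (2 * v)) /
    (Real.sqrt (2 * π) * Real.sqrt v * Real.cosh (a * μ + b) * Real.exp (a ^ 2 * v / 2))

lemma gibbs_nonneg {N : ℕ} (β h : ℝ) (G : Disorder N) (σ : Config N) : 0 ≤ gibbs β h G σ :=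
  div_nonneg (Real.exp_pos _).le (Finset.sum_nonneg fun _ _ => (Real.exp_pos _).le)

lemma sum_gibbs {N : ℕ} (β h : ℝ) (G : Disorder N) : ∑ σ, gibbs β h G σ = 1 := by
  unfold gibbs
  rw [← Finset.sum_div]
  exact div_self (Finset.sum_pos (fun _ _ => Real.exp_pos _) Finset.univ_nonempty).ne'

lemma gibbs_le_one {N : ℕ} (β h : ℝ) (G : Disorder N) (σ : Config N) : gibbs β h G σ ≤ 1 :=
  (Finset.single_le_sum (fun τ _ => gibbs_nonneg β h G τ) (Finset.mem_univ σ)).trans_eq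
    (sum_gibbs β h G)

lemma measurable_gibbs {N : ℕ} (β h : ℝ) (σ : Config N) :
    Measurable fun G : Disorder N => gibbs β h G σ := by
  unfold gibbs Zpart ham
  fun_prop

instance (N : ℕ) : IsProbabilityMeasure (μdis N) := by
  unfold μdis
  infer_instance

/-- A real function that is measurable and bounded. -/
def BoundedMeasurable {α : Type*} [MeasurableSpace α] (f : α → ℝ) : Prop :=
  Measurable f ∧ ∃ M, ∀ x, |f x| ≤ M

namespace BoundedMeasurable

variable {α : Type*} [MeasurableSpace α] {f g : α → ℝ}

lemma integrable {μ : Measure α} [IsFiniteMeasure μ] (hf : BoundedMeasurable f) :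
    Integrable f μ := by
  obtain ⟨M, hM⟩ := hf.2
  exact Integrable.of_bound hf.1.aestronglyMeasurable M (.of_forall hM)

lemma const (c : ℝ) : BoundedMeasurable fun _ : α => c :=
  ⟨measurable_const, |c|, fun _ => le_rfl⟩

lemma sub (hf : BoundedMeasurable f) (hg : BoundedMeasurable g) :
    BoundedMeasurable fun x => f x - g x := by
  obtain ⟨M, hM⟩ := hf.2
  obtain ⟨L, hL⟩ := hg.2
  exact ⟨hf.1.sub hg.1, M + L, fun x => (abs_sub _ _).trans (add_le_add (hM x) (hL x))⟩

lemma mul (hf : BoundedMeasurable f) (hg : BoundedMeasurable g) :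
    BoundedMeasurable fun x => f x * g x := by
  obtain ⟨M, hM⟩ := hf.2
  obtain ⟨L, hL⟩ := hg.2
  refine ⟨hf.1.mul hg.1, M * L, fun x => ?_⟩
  rw [abs_mul]
  exact mul_le_mul (hM x) (hL x) (abs_nonneg _) ((abs_nonneg _).trans (hM x))

lemma pow_two (hf : BoundedMeasurable f) : BoundedMeasurable fun x => f x ^ 2 := by
  simpa only [sq] using hf.mul hf

lemma sum {ι : Type*} {s : Finset ι} {F : ι → α → ℝ} (hF : ∀ i, BoundedMeasurable (F i)) :
    BoundedMeasurable fun x => ∑ i ∈ s, F i x := by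
  choose M hM using fun i => (hF i).2
  exact ⟨Finset.measurable_fun_sum _ fun i _ => (hF i).1, ∑ i ∈ s, M i, fun x =>
    (Finset.abs_sum_le_sum_abs _ _).trans (Finset.sum_le_sum fun i _ => hM i x)⟩

lemma gibbs {N : ℕ} (β h : ℝ) (σ : Config N) :
    BoundedMeasurable fun G : Disorder N => SK.gibbs β h G σ :=
  ⟨measurable_gibbs β h σ, 1, fun G => by
    rw [abs_of_nonneg (gibbs_nonneg β h G σ)]
    exact gibbs_le_one β h G σ⟩

lemma qavg {N : ℕ} (β h : ℝ) {f : Disorder N → Config N → ℝ}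
    (hf : ∀ σ, BoundedMeasurable fun G => f G σ) :
    BoundedMeasurable fun G => SK.qavg β h G (f G) :=
  sum fun σ => (hf σ).mul (gibbs β h σ)

lemma qavg2 {N : ℕ} (β h : ℝ) (f : Config N → Config N → ℝ) :
    BoundedMeasurable fun G : Disorder N => SK.qavg2 β h G f :=
  sum fun σ₁ => sum fun σ₂ => ((const _).mul (gibbs β h σ₁)).mul (gibbs β h σ₂)

/-- Cauchy–Schwarz for a function whose square is dominated by a product. -/
lemma integral_le_sqrt_mul_sqrt {μ : Measure α} [IsFiniteMeasure μ] {x : α → ℝ}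
    (hx : BoundedMeasurable x) (hf : BoundedMeasurable f) (hg : BoundedMeasurable g)
    (hf₀ : ∀ a, 0 ≤ f a) (hg₀ : ∀ a, 0 ≤ g a) (hxfg : ∀ a, x a ^ 2 ≤ f a * g a) :
    ∫ a, x a ∂μ ≤ √(∫ a, f a ∂μ) * √(∫ a, g a ∂μ) := by
  have sqrt_bounded {u : α → ℝ} (hu : BoundedMeasurable u) :
      BoundedMeasurable fun a => √(u a) := by
    obtain ⟨M, hM⟩ := hu.2
    refine ⟨hu.1.sqrt, √M, fun a => ?_⟩
    rw [abs_of_nonneg (Real.sqrt_nonneg _)]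
    exact Real.sqrt_le_sqrt ((le_abs_self _).trans (hM a))
  have memLp {u : α → ℝ} (hu : BoundedMeasurable u) :
      MemLp (fun a => √(u a)) (ENNReal.ofReal 2) μ := by
    obtain ⟨M, hM⟩ := (sqrt_bounded hu).2
    exact MemLp.of_bound (sqrt_bounded hu).1.aestronglyMeasurable M (.of_forall hM)
  have holder := integral_mul_le_Lp_mul_Lq_of_nonneg (μ := μ) Real.HolderConjugate.two_two
    (.of_forall fun a => Real.sqrt_nonneg (f a)) (.of_forall fun a => Real.sqrt_nonneg (g a))
    (memLp hf) (memLp hg)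
  simp only [Real.rpow_two, Real.sq_sqrt (hf₀ _), Real.sq_sqrt (hg₀ _),
    ← Real.sqrt_eq_rpow] at holder
  refine le_trans ?_ holder
  refine integral_mono hx.integrable ((sqrt_bounded hf).mul (sqrt_bounded hg)).integrable
    fun a => ?_
  change x a ≤ √(f a) * √(g a)
  rw [← Real.sqrt_mul (hf₀ a)]
  exact Real.le_sqrt_of_sq_le (hxfg a)

end BoundedMeasurable

lemma qavg_nonneg {N : ℕ} (β h : ℝ) (G : Disorder N) {f : Config N → ℝ} (hf : ∀ σ, 0 ≤ f σ) :
    0 ≤ qavg β h G f :=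
  Finset.sum_nonneg fun σ _ => mul_nonneg (hf σ) (gibbs_nonneg β h G σ)

lemma qavg2_nonneg {N : ℕ} (β h : ℝ) (G : Disorder N) {f : Config N → Config N → ℝ}
    (hf : ∀ σ τ, 0 ≤ f σ τ) : 0 ≤ qavg2 β h G f :=
  Finset.sum_nonneg fun σ _ => Finset.sum_nonneg fun τ _ =>
    mul_nonneg (mul_nonneg (hf σ τ) (gibbs_nonneg β h G σ)) (gibbs_nonneg β h G τ)

/-- Cauchy–Schwarz for the two-replica average. -/
lemma qavg2_mul_sq_le {N : ℕ} (β h : ℝ) (G : Disorder N) (f g : Config N → Config N → ℝ) :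
    qavg2 β h G (fun σ τ => f σ τ * g σ τ) ^ 2 ≤
      qavg2 β h G (fun σ τ => f σ τ ^ 2) * qavg2 β h G (fun σ τ => g σ τ ^ 2) := by
  unfold qavg2
  simp only [← Fintype.sum_prod_type']
  have hp := gibbs_nonneg β h G
  refine Finset.sum_sq_le_sum_mul_sum_of_sq_le_mul _
    (fun x _ => mul_nonneg (mul_nonneg (sq_nonneg _) (hp _)) (hp _))
    (fun x _ => mul_nonneg (mul_nonneg (sq_nonneg _) (hp _)) (hp _)) fun x _ => le_of_eq (by ring)

lemma qavg2_mul {N : ℕ} (β h : ℝ) (G : Disorder N) (f g : Config N → ℝ) :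
    qavg2 β h G (fun σ τ => f σ * g τ) = qavg β h G f * qavg β h G g := by
  unfold qavg qavg2
  rw [Finset.sum_mul_sum]
  exact Finset.sum_congr rfl fun σ _ => Finset.sum_congr rfl fun τ _ => by ring

lemma qavg2_one {N : ℕ} (β h : ℝ) (G : Disorder N) : qavg2 β h G (fun _ _ => 1) = 1 := by
  have := qavg2_mul β h G (fun _ => 1) (fun _ => 1)
  simpa [qavg, sum_gibbs] using this

lemma qavg_sub_const {N : ℕ} (β h : ℝ) (G : Disorder N) (f : Config N → ℝ) (c : ℝ) :
    qavg β h G (fun σ => f σ - c) = qavg β h G f - c := by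
  simp [qavg, sub_mul, Finset.sum_sub_distrib, ← Finset.mul_sum, sum_gibbs]

lemma qavg_sub_mean_sq_le {N : ℕ} (β h : ℝ) (G : Disorder N) (f : Config N → ℝ) :
    qavg β h G (fun σ => (f σ - qavg β h G f) ^ 2) ≤ qavg β h G (fun σ => f σ ^ 2) := by
  have key : qavg β h G (fun σ => (f σ - qavg β h G f) ^ 2) =
      qavg β h G (fun σ => f σ ^ 2) - qavg β h G f ^ 2 := by
    set c := qavg β h G f with hc
    have expand : qavg β h G (fun σ => (f σ - c) ^ 2) =
        qavg β h G (fun σ => f σ ^ 2) - 2 * c * qavg β h G f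
          + c ^ 2 * ∑ σ, gibbs β h G σ := by
      simp only [qavg, Finset.mul_sum, ← Finset.sum_sub_distrib, ← Finset.sum_add_distrib]
      exact Finset.sum_congr rfl fun σ _ => by ring
    rw [expand, sum_gibbs, ← hc]
    ring
  rw [key]
  exact sub_le_self _ (sq_nonneg _)

lemma qavg_centered_mul {N : ℕ} (β h : ℝ) (G : Disorder N) (f g : Config N → ℝ) :
    qavg β h G (fun σ => (f σ - qavg β h G f) * g σ) =
      qavg β h G (fun σ => (g σ - qavg β h G g) * f σ) := by
  have expand (u v : Config N → ℝ) :
      qavg β h G (fun σ => (u σ - qavg β h G u) * v σ) =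
        qavg β h G (fun σ => u σ * v σ) - qavg β h G u * qavg β h G v := by
    generalize qavg β h G u = c
    simp only [qavg, Finset.mul_sum, ← Finset.sum_sub_distrib]
    exact Finset.sum_congr rfl fun σ _ => by ring
  rw [expand, expand]
  simp only [mul_comm]

lemma sum_qavg_spin_mul_qavg_spin {N : ℕ} (hN : (N : ℝ) ≠ 0) (β h : ℝ) (G : Disorder N)
    (f g : Config N → ℝ) :
    ∑ j, qavg β h G (fun σ => f σ * spin (σ j)) * qavg β h G (fun σ => g σ * spin (σ j)) =
      N * qavg2 β h G (fun σ τ => overlap σ τ * (f σ * g τ)) := by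
  simp only [← qavg2_mul]
  unfold qavg2 overlap
  rw [Finset.sum_comm, Finset.mul_sum]
  refine Finset.sum_congr rfl fun σ _ => ?_
  rw [Finset.sum_comm, Finset.mul_sum]
  refine Finset.sum_congr rfl fun τ _ => ?_
  simp only [Finset.mul_sum, Finset.sum_mul]
  refine Finset.sum_congr rfl fun j _ => ?_
  field_simp

lemma sum_qavg_centered_sq_le {N : ℕ} (hN : (N : ℝ) ≠ 0) (β h q : ℝ) (G : Disorder N)
    (v w : Config N → ℝ) :
    (∑ j, qavg β h G (fun σ => (spin (σ j) - mavg β h G j) * v σ)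
        * qavg β h G (fun σ => w σ * spin (σ j))) ^ 2 ≤
      ((N : ℝ) ^ 2 * qavg2 β h G (fun σ τ => (overlap σ τ - q) ^ 2)) *
        (qavg β h G (fun σ => v σ ^ 2) * qavg β h G (fun σ => w σ ^ 2)) := by
  set u : Config N → ℝ := fun σ => v σ - qavg β h G v with hu
  have hu₀ : qavg β h G u = 0 := by rw [hu, qavg_sub_const, sub_self]
  have hsum : ∑ j, qavg β h G (fun σ => (spin (σ j) - mavg β h G j) * v σ)
        * qavg β h G (fun σ => w σ * spin (σ j)) =
      N * qavg2 β h G (fun σ τ => (overlap σ τ - q) * (u σ * w τ)) := by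
    have hq : qavg2 β h G (fun σ τ => (overlap σ τ - q) * (u σ * w τ)) =
        qavg2 β h G (fun σ τ => overlap σ τ * (u σ * w τ)) -
          q * qavg2 β h G (fun σ τ => u σ * w τ) := by
      simp only [qavg2, Finset.mul_sum, ← Finset.sum_sub_distrib]
      exact Finset.sum_congr rfl fun σ _ => Finset.sum_congr rfl fun τ _ => by ring
    rw [hq, qavg2_mul, hu₀, zero_mul, mul_zero, sub_zero, ← sum_qavg_spin_mul_qavg_spin hN]
    refine Finset.sum_congr rfl fun j _ => ?_
    congr 1
    exact qavg_centered_mul β h G (fun σ => spin (σ j)) v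
  have hcs := qavg2_mul_sq_le β h G (fun σ τ => overlap σ τ - q) (fun σ τ => u σ * w τ)
  simp only [mul_pow] at hcs
  rw [qavg2_mul β h G (fun σ => u σ ^ 2) (fun σ => w σ ^ 2)] at hcs
  rw [hsum, mul_pow, mul_assoc]
  refine mul_le_mul_of_nonneg_left (hcs.trans ?_) (sq_nonneg _)
  exact mul_le_mul_of_nonneg_left
    (mul_le_mul_of_nonneg_right (qavg_sub_mean_sq_le β h G v)
      (qavg_nonneg β h G fun _ => sq_nonneg _))
    (qavg2_nonneg β h G fun _ _ => sq_nonneg _)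

lemma integral_overlap_sq_le {N : ℕ} {β h q K : ℝ} (hT : highTemp N β h q K) :
    ∫ G, qavg2 β h G (fun σ τ => (overlap σ τ - q) ^ 2) ∂(μdis N) ≤ √K / N := by
  have hcs := BoundedMeasurable.integral_le_sqrt_mul_sqrt (μ := μdis N)
    (.qavg2 β h fun σ τ => (overlap σ τ - q) ^ 2) (.qavg2 β h fun σ τ => (overlap σ τ - q) ^ 4)
    (.const 1) (fun G => qavg2_nonneg β h G fun σ τ => by positivity) (fun _ => zero_le_one)
    fun G => by
      have := qavg2_mul_sq_le β h G (fun σ τ => (overlap σ τ - q) ^ 2) (fun _ _ => 1)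
      simpa only [mul_one, one_pow, qavg2_one, ← pow_mul] using this
  simp only [integral_const, probReal_univ, smul_eq_mul, mul_one, Real.sqrt_one] at hcs
  refine hcs.trans ((Real.sqrt_le_sqrt hT).trans_eq ?_)
  rw [Real.sqrt_div' _ (sq_nonneg _), Real.sqrt_sq N.cast_nonneg]

/-- Lemma 3.1. -/
theorem jk_bound (β h K : ℝ) (hβ : 0 < β) (hK : 0 < K) :
    ∃ C : ℝ, 0 < C ∧ ∀ (N : ℕ) (q : ℝ), 2 ≤ N → 0 ≤ q → q < 1 →
      highTemp N β h q K →
      ∀ v w : Fin N → Disorder N → Config N → ℝ,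
      (∀ k σ, Measurable fun G => v k G σ) →
      (∀ k σ, Measurable fun G => w k G σ) →
      (∀ k, ∃ M : ℝ, ∀ G σ, |v k G σ| ≤ M ∧ |w k G σ| ≤ M) →
        ∫ G, (1 / (N : ℝ) ^ 2) * ∑ j : Fin N, ∑ k : Fin N,
              qavg β h G (fun σ => (spin (σ j) - mavg β h G j) * v k G σ)
                * qavg β h G (fun σ => w k G σ * spin (σ j)) ∂(μdis N)
        ≤ C / ((N : ℝ) * Real.sqrt N) * ∑ k : Fin N,
            Real.sqrt (∫ G, qavg β h G (fun σ => v k G σ ^ 2)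
              * qavg β h G (fun σ => w k G σ ^ 2) ∂(μdis N)) := by
  refine ⟨√√K, by positivity, fun N q hN _ _ hT v w hv hw hb => ?_⟩
  have hN₀ : (0 : ℝ) < N := by exact_mod_cast (by omega : 0 < N)
  choose M hM using hb
  have hvb (k σ) : BoundedMeasurable fun G => v k G σ := ⟨hv k σ, M k, fun G => (hM k G σ).1⟩
  have hwb (k σ) : BoundedMeasurable fun G => w k G σ := ⟨hw k σ, M k, fun G => (hM k G σ).2⟩
  have hX (k : Fin N) : BoundedMeasurable fun G => ∑ j,
      qavg β h G (fun σ => (spin (σ j) - mavg β h G j) * v k G σ)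
        * qavg β h G (fun σ => w k G σ * spin (σ j)) :=
    .sum fun j => .mul
      (.qavg β h fun σ => .mul (.sub (.const _) (.qavg β h fun _ => .const _)) (hvb k σ))
      (.qavg β h fun σ => .mul (hwb k σ) (.const _))
  have hbound (k : Fin N) : ∫ G, ∑ j,
      qavg β h G (fun σ => (spin (σ j) - mavg β h G j) * v k G σ)
        * qavg β h G (fun σ => w k G σ * spin (σ j)) ∂(μdis N) ≤
      √((N : ℝ) * √K) * √(∫ G, qavg β h G (fun σ => v k G σ ^ 2)
        * qavg β h G (fun σ => w k G σ ^ 2) ∂(μdis N)) := by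
    refine ((hX k).integral_le_sqrt_mul_sqrt
      ((BoundedMeasurable.const ((N : ℝ) ^ 2)).mul
        (.qavg2 β h fun σ τ => (overlap σ τ - q) ^ 2))
      (.mul (.qavg β h fun σ => (hvb k σ).pow_two) (.qavg β h fun σ => (hwb k σ).pow_two))
      (fun G => mul_nonneg (sq_nonneg _) (qavg2_nonneg β h G fun _ _ => sq_nonneg _))
      (fun G => mul_nonneg (qavg_nonneg β h G fun _ => sq_nonneg _)
        (qavg_nonneg β h G fun _ => sq_nonneg _))
      fun G => sum_qavg_centered_sq_le hN₀.ne' β h q G (v k G) (w k G)).trans ?_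
    refine mul_le_mul_of_nonneg_right (Real.sqrt_le_sqrt ?_) (Real.sqrt_nonneg _)
    rw [integral_const_mul]
    calc (N : ℝ) ^ 2 * _ ≤ (N : ℝ) ^ 2 * (√K / N) :=
          mul_le_mul_of_nonneg_left (integral_overlap_sq_le hT) (sq_nonneg _)
      _ = N * √K := by field_simp
  have hconst : 1 / (N : ℝ) ^ 2 * √(N * √K) = √√K / (N * √N) := by
    rw [Real.sqrt_mul hN₀.le, div_mul_eq_mul_div, one_mul,
      div_eq_div_iff (by positivity) (by positivity)]
    linear_combination (N : ℝ) * √√K * Real.mul_self_sqrt hN₀.le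
  rw [integral_const_mul, integral_congr_ae (.of_forall fun G => Finset.sum_comm),
    integral_finsetSum _ fun k _ => (hX k).integrable, ← hconst, mul_assoc]
  refine mul_le_mul_of_nonneg_left ?_ (by positivity)
  rw [Finset.mul_sum]
  exact Finset.sum_le_sum fun k _ => hbound k

end SK
end

section
/- For all a, b, μ ∈ ℝ and σ² > 0, ∫_ℝ tanh(ax + b) ψ_{a,b,μ,σ²}(x) dx = tanh(aμ + b). -/
open MeasureTheory ProbabilityTheory Real Finset

namespace SK

/-- An exponentially tilted Gaussian density is a multiple of a translated one. -/
lemma exp_mul_exp_neg_sq (a b μ x : ℝ) {v : ℝ} (hv : 0 < v) :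
    Real.exp (a * x + b) * Real.exp (-(x - μ) ^ 2 / (2 * v)) =
      Real.exp (a * μ + b) * Real.exp (a ^ 2 * v / 2) *
        Real.exp (-(x - (μ + a * v)) ^ 2 / (2 * v)) := by
  simp only [← Real.exp_add]
  congr 1
  field_simp
  ring

/-- `tanh (a x + b)` times the mixture density is a linear combination of two Gaussian densities. -/
lemma tanh_mul_mixDens (a b μ : ℝ) {v : ℝ} (hv : 0 < v) (x : ℝ) :
    Real.tanh (a * x + b) * mixDens a b μ v x =
      Real.exp (a * μ + b) / (2 * Real.cosh (a * μ + b)) *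
          gaussianPDFReal (μ + a * v) v.toNNReal x -
        Real.exp (-(a * μ + b)) / (2 * Real.cosh (a * μ + b)) *
          gaussianPDFReal (μ - a * v) v.toNNReal x := by
  have hplus := exp_mul_exp_neg_sq a b μ x hv
  have hminus := exp_mul_exp_neg_sq (-a) (-b) μ x hv
  rw [neg_sq, show -a * x + -b = -(a * x + b) by ring, show -a * μ + -b = -(a * μ + b) by ring,
    show μ + -a * v = μ - a * v by ring] at hminus
  have hnum : Real.sinh (a * x + b) * Real.exp (-(x - μ) ^ 2 / (2 * v)) =
      Real.exp (a ^ 2 * v / 2) / 2 *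
        (Real.exp (a * μ + b) * Real.exp (-(x - (μ + a * v)) ^ 2 / (2 * v)) -
          Real.exp (-(a * μ + b)) * Real.exp (-(x - (μ - a * v)) ^ 2 / (2 * v))) := by
    rw [Real.sinh_eq]
    linear_combination (hplus - hminus) / 2
  have hx := (Real.cosh_pos (a * x + b)).ne'
  have hμ := (Real.cosh_pos (a * μ + b)).ne'
  have hs := (Real.sqrt_pos.2 hv).ne'
  have hexp := (Real.exp_pos (a ^ 2 * v / 2)).ne'
  have hpi : √(2 * π) ≠ 0 := by positivity
  rw [mixDens, Real.tanh_eq_sinh_div_cosh, div_mul_div_comm, ← mul_assoc,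
    mul_right_comm, mul_comm (Real.cosh (a * x + b)) (_ * _ * _ * _), mul_div_mul_right _ _ hx,
    hnum]
  simp only [gaussianPDFReal, Real.coe_toNNReal v hv.le]
  rw [Real.sqrt_mul (by positivity : (0 : ℝ) ≤ 2 * π)]
  generalize √(2 * π) = c at *
  field_simp

/-- Identity (1.12)/(1.7): the `tanh` identity for mixture-Gaussian densities. -/
theorem tanh_mixture_identity (a b μ v : ℝ) (hv : 0 < v) :
    ∫ x, Real.tanh (a * x + b) * mixDens a b μ v x = Real.tanh (a * μ + b) := by
  have hv' : v.toNNReal ≠ 0 := (Real.toNNReal_pos.2 hv).ne'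
  simp_rw [tanh_mul_mixDens a b μ hv]
  rw [integral_sub ((integrable_gaussianPDFReal _ _).const_mul _)
      ((integrable_gaussianPDFReal _ _).const_mul _),
    integral_const_mul, integral_const_mul, integral_gaussianPDFReal_eq_one _ hv',
    integral_gaussianPDFReal_eq_one _ hv', Real.tanh_eq_sinh_div_cosh, Real.sinh_eq]
  ring

end SK
end

section
/- Let σ² > 0, p ∈ (0,1), and μ₁ > μ₂, and let X be a real random variable with density p φ_{μ₁,σ²} + (1-p) φ_{μ₂,σ²}. Set a = (μ₁ - μ₂)/(2σ²) and b = (1/2) log(p/(1-p)) - (μ₁² - μ₂²)/(4σ²). Then E tanh(aX + b) = tanh( a E(X) + b - (2p - 1) a² σ² ). -/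
open MeasureTheory ProbabilityTheory Real Finset

namespace SK

theorem gaussDens_eq_gaussianPDFReal (μ v x : ℝ) (hv : 0 < v) :
    gaussDens μ v x = gaussianPDFReal μ v.toNNReal x := by
  rw [gaussDens, gaussianPDFReal, Real.coe_toNNReal v hv.le,
    Real.sqrt_mul (by positivity : (0 : ℝ) ≤ 2 * π), one_div]

theorem gaussDens_pos (μ v x : ℝ) (hv : 0 < v) : 0 < gaussDens μ v x := by
  unfold gaussDens
  positivity

theorem measurable_gaussDens (μ v : ℝ) : Measurable (gaussDens μ v) := by
  unfold gaussDens
  fun_prop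

theorem integrable_gaussDens (μ v : ℝ) (hv : 0 < v) : Integrable (gaussDens μ v) := by
  rw [funext fun x => gaussDens_eq_gaussianPDFReal μ v x hv]
  exact integrable_gaussianPDFReal μ v.toNNReal

theorem integral_gaussDens (μ v : ℝ) (hv : 0 < v) : ∫ x, gaussDens μ v x = 1 := by
  simpa only [gaussDens_eq_gaussianPDFReal _ _ _ hv] using
    integral_gaussianPDFReal_eq_one μ (Real.toNNReal_pos.2 hv).ne'

theorem integrable_gaussDens_mul_id (μ v : ℝ) (hv : 0 < v) :
    Integrable fun x => gaussDens μ v x * x := by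
  have h : Integrable (fun x : ℝ => x) (gaussianReal μ v.toNNReal) :=
    (memLp_id_gaussianReal' 1 ENNReal.one_ne_top).integrable le_rfl
  rw [gaussianReal_of_var_ne_zero _ (Real.toNNReal_pos.2 hv).ne',
    integrable_withDensity_iff_integrable_smul' (measurable_gaussianPDF _ _)
      (by simp [gaussianPDF])] at h
  simpa only [toReal_gaussianPDF, smul_eq_mul, ← gaussDens_eq_gaussianPDFReal _ _ _ hv] using h

theorem integral_gaussDens_mul_id (μ v : ℝ) (hv : 0 < v) :
    ∫ x, gaussDens μ v x * x = μ := by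
  have h := integral_id_gaussianReal (μ := μ) (v := v.toNNReal)
  rw [integral_gaussianReal_eq_integral_smul (Real.toNNReal_pos.2 hv).ne'] at h
  simpa only [smul_eq_mul, ← gaussDens_eq_gaussianPDFReal _ _ _ hv] using h

theorem integral_comp_eq_integral_density_mul {Ω : Type*} [MeasurableSpace Ω] {P : Measure Ω}
    {X : Ω → ℝ} (hX : Measurable X) {f g : ℝ → ℝ} (hf : Measurable f) (hf0 : ∀ x, 0 ≤ f x)
    (hg : Measurable g)
    (hdens : Measure.map X P = volume.withDensity fun x => ENNReal.ofReal (f x)) :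
    ∫ ω, g (X ω) ∂P = ∫ x, f x * g x := by
  rw [← integral_map hX.aemeasurable hg.aestronglyMeasurable, hdens,
    integral_withDensity_eq_integral_toReal_smul hf.ennreal_ofReal (by simp)]
  simp only [ENNReal.toReal_ofReal (hf0 _), smul_eq_mul]

theorem add_mul_tanh_eq_sub {y u w : ℝ} (h : u = Real.exp (2 * y) * w) :
    (u + w) * Real.tanh y = u - w := by
  have h2 : Real.exp (2 * y) = Real.exp y * Real.exp y := by rw [← Real.exp_add, two_mul]
  have h3 : Real.exp y * Real.exp (-y) = 1 := by rw [← Real.exp_add]; simp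
  have hy := Real.exp_pos y
  have hy' := Real.exp_pos (-y)
  rw [Real.tanh_eq, h, h2, mul_div_assoc', div_eq_iff (by positivity)]
  linear_combination (-2 * w * Real.exp y) * h3

theorem tanh_half_log_odds {p : ℝ} (hp : 0 < p) (hp1 : p < 1) :
    Real.tanh (1 / 2 * Real.log (p / (1 - p))) = 2 * p - 1 := by
  have hq : 0 < 1 - p := sub_pos.2 hp1
  have h := add_mul_tanh_eq_sub (y := 1 / 2 * Real.log (p / (1 - p))) (u := p) (w := 1 - p) (by
    rw [← mul_assoc, show (2 : ℝ) * (1 / 2) = 1 by norm_num, one_mul,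
      Real.exp_log (by positivity), div_mul_cancel₀ _ hq.ne'])
  linarith

theorem mixture_mul_tanh_eq_sub {μ₁ μ₂ v p : ℝ} (hv : 0 < v) (hp : 0 < p) (hp1 : p < 1) (x : ℝ) :
    (p * gaussDens μ₁ v x + (1 - p) * gaussDens μ₂ v x) *
        Real.tanh ((μ₁ - μ₂) / (2 * v) * x
          + (1 / 2 * Real.log (p / (1 - p)) - (μ₁ ^ 2 - μ₂ ^ 2) / (4 * v)))
      = p * gaussDens μ₁ v x - (1 - p) * gaussDens μ₂ v x := by
  have hq : 0 < 1 - p := sub_pos.2 hp1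
  apply add_mul_tanh_eq_sub
  have hexp : Real.exp (2 * ((μ₁ - μ₂) / (2 * v) * x
      + (1 / 2 * Real.log (p / (1 - p)) - (μ₁ ^ 2 - μ₂ ^ 2) / (4 * v))))
      = p / (1 - p) *
        Real.exp (-(x - μ₁) ^ 2 / (2 * v) - -(x - μ₂) ^ 2 / (2 * v)) := by
    rw [← Real.exp_log (show 0 < p / (1 - p) by positivity), ← Real.exp_add, Real.log_exp]
    congr 1
    field_simp
    ring
  rw [hexp, Real.exp_sub]
  unfold gaussDens
  field_simp

/-- Identity (1.7): moving the expectation inside `tanh` for a mixture of two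
Gaussian densities, with the quadratic correction term `-(2p-1)a²σ²`. -/
theorem tanh_mixture_expectation {Ω : Type*} [MeasurableSpace Ω] (P : Measure Ω)
    [IsProbabilityMeasure P] (X : Ω → ℝ) (hXm : Measurable X)
    (hXint : Integrable X P) (μ₁ μ₂ v p : ℝ) (hv : 0 < v) (hp : 0 < p)
    (hp1 : p < 1) (hμ : μ₂ < μ₁)
    (hdens : Measure.map X P = volume.withDensity
      (fun x => ENNReal.ofReal
        (p * gaussDens μ₁ v x + (1 - p) * gaussDens μ₂ v x))) :
    ∫ ω, Real.tanh (((μ₁ - μ₂) / (2 * v)) * X ω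
        + ((1 / 2) * Real.log (p / (1 - p)) - (μ₁ ^ 2 - μ₂ ^ 2) / (4 * v))) ∂P
      = Real.tanh (((μ₁ - μ₂) / (2 * v)) * (∫ ω, X ω ∂P)
        + ((1 / 2) * Real.log (p / (1 - p)) - (μ₁ ^ 2 - μ₂ ^ 2) / (4 * v))
        - (2 * p - 1) * ((μ₁ - μ₂) / (2 * v)) ^ 2 * v) := by
  have hq : 0 < 1 - p := sub_pos.2 hp1
  have hf : Measurable fun x => p * gaussDens μ₁ v x + (1 - p) * gaussDens μ₂ v x :=
    ((measurable_gaussDens _ _).const_mul _).add ((measurable_gaussDens _ _).const_mul _)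
  have hf0 : ∀ x, 0 ≤ p * gaussDens μ₁ v x + (1 - p) * gaussDens μ₂ v x := fun x =>
    add_nonneg (mul_nonneg hp.le (gaussDens_pos _ _ _ hv).le)
      (mul_nonneg hq.le (gaussDens_pos _ _ _ hv).le)
  have hmean : ∫ ω, X ω ∂P = p * μ₁ + (1 - p) * μ₂ := by
    rw [integral_comp_eq_integral_density_mul hXm hf hf0 measurable_id' hdens]
    simp only [add_mul, mul_assoc]
    rw [integral_add ((integrable_gaussDens_mul_id _ _ hv).const_mul _)
      ((integrable_gaussDens_mul_id _ _ hv).const_mul _), integral_const_mul,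
      integral_const_mul, integral_gaussDens_mul_id _ _ hv, integral_gaussDens_mul_id _ _ hv]
  have htanh : Measurable Real.tanh := by
    rw [show Real.tanh = fun x => Real.sinh x / Real.cosh x from funext Real.tanh_eq_sinh_div_cosh]
    fun_prop
  have hlhs := integral_comp_eq_integral_density_mul hXm hf hf0
    (g := fun x => Real.tanh ((μ₁ - μ₂) / (2 * v) * x
      + (1 / 2 * Real.log (p / (1 - p)) - (μ₁ ^ 2 - μ₂ ^ 2) / (4 * v))))
    (htanh.comp (by fun_prop)) hdens
  simp only [mixture_mul_tanh_eq_sub hv hp hp1] at hlhs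
  rw [hlhs, integral_sub ((integrable_gaussDens _ _ hv).const_mul _)
    ((integrable_gaussDens _ _ hv).const_mul _), integral_const_mul, integral_const_mul,
    integral_gaussDens _ _ hv, integral_gaussDens _ _ hv, hmean]
  trans Real.tanh (1 / 2 * Real.log (p / (1 - p)))
  · rw [tanh_half_log_odds hp hp1]
    ring
  · congr 1
    field_simp
    ring

end SK
end

section
/- Let a, b, μ ∈ ℝ, σ² > 0, and let W be a real random variable with density ψ_{a,b,μ,σ²}. Then for every bounded, absolutely continuous f : ℝ → ℝ with bounded derivative, E[ f'(W) - ( (W - μ)/σ² - a tanh(aW + b) ) f(W) ] = 0. That is, Tf(x) = f'(x) - ((x-μ)/σ² - a tanh(ax+b)) f(x) is a Stein characterizing operator for the mixture Gaussian distribution M(a,b,μ,σ²). -/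
open MeasureTheory ProbabilityTheory Real Finset

namespace SK

open Filter Topology in
/-- Integration by parts on `ℝ` for a bounded absolutely continuous function `f` with bounded
derivative against an integrable `C¹` function `g` with integrable derivative. -/
theorem integral_deriv_mul_add_mul_deriv_eq_zero {f f' g : ℝ → ℝ} (hf' : Measurable f')
    (hAC : ∀ x y : ℝ, f x - f y = ∫ t in y..x, f' t)
    {M M' : ℝ} (hfb : ∀ x, |f x| ≤ M) (hf'b : ∀ x, |f' x| ≤ M')
    (hg : ContDiff ℝ 1 g) (hgi : Integrable g) (hg'i : Integrable (deriv g)) :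
    Integrable (fun x => f' x * g x + f x * deriv g x) ∧
      ∫ x, (f' x * g x + f x * deriv g x) = 0 := by
  have hf'ii (x y : ℝ) : IntervalIntegrable f' volume x y :=
    intervalIntegrable_const.mono_fun' hf'.aestronglyMeasurable (ae_of_all _ hf'b)
  have hf'loc : LocallyIntegrable f' :=
    (locallyIntegrable_const M').mono hf'.aestronglyMeasurable
      (ae_of_all _ fun x => (hf'b x).trans (le_abs_self M'))
  have hfeq : f = fun x => f 0 + ∫ t in (0 : ℝ)..x, f' t := by
    funext x
    rw [← hAC x 0]
    ring
  have hderiv : ∀ᵐ x, deriv f x = f' x := by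
    filter_upwards [_root_.LocallyIntegrable.ae_hasDerivAt_integral hf'loc] with x hx
    rw [hfeq]
    exact ((hx 0).const_add (f 0)).deriv
  have hfc : Continuous f := by
    rw [hfeq]
    exact continuous_const.add (intervalIntegral.continuous_primitive hf'ii 0)
  have hf_ac (x y : ℝ) : AbsolutelyContinuousOnInterval f x y := by
    have hlip : LipschitzOnWith (Real.toNNReal M') f (Set.uIcc x y) := by
      refine LipschitzOnWith.of_dist_le_mul fun s _ t _ => ?_
      rw [Real.dist_eq, Real.dist_eq, hAC s t,
        Real.coe_toNNReal _ ((abs_nonneg _).trans (hf'b 0))]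
      exact intervalIntegral.norm_integral_le_of_norm_le_const (f := f') fun u _ => hf'b u
    exact hlip.absolutelyContinuousOnInterval
  have hint : Integrable (fun x => f' x * g x + f x * deriv g x) :=
    (hgi.bdd_mul hf'.aestronglyMeasurable (ae_of_all _ hf'b)).add
      (hg'i.bdd_mul hfc.aestronglyMeasurable (ae_of_all _ hfb))
  refine ⟨hint, ?_⟩
  have hgd (x : ℝ) : HasDerivAt g (deriv g x) x :=
    (hg.differentiable one_ne_zero x).hasDerivAt
  have htop : Tendsto g atTop (𝓝 0) :=
    tendsto_zero_of_hasDerivAt_of_integrableOn_Ioi (a := 0) (fun x _ => hgd x)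
      hg'i.integrableOn hgi.integrableOn
  have hbot : Tendsto g atBot (𝓝 0) :=
    tendsto_zero_of_hasDerivAt_of_integrableOn_Iic (a := 0) (fun x _ => hgd x)
      hg'i.integrableOn hgi.integrableOn
  have hfg {l : Filter ℝ} (h : Tendsto g l (𝓝 0)) : Tendsto (fun x => f x * g x) l (𝓝 0) :=
    bdd_le_mul_tendsto_zero' M (Eventually.of_forall hfb) h
  have hlim := intervalIntegral_tendsto_integral hint tendsto_neg_atTop_atBot tendsto_id
  have hparts (r : ℝ) :
      ∫ x in -r..r, (f' x * g x + f x * deriv g x) = f r * g r - f (-r) * g (-r) := by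
    rw [← (hf_ac (-r) r).integral_deriv_mul_eq_sub hg.contDiffOn.absolutelyContinuousOnInterval]
    refine intervalIntegral.integral_congr_ae ?_
    filter_upwards [hderiv] with x hx _
    rw [hx]
  have hlim' : Tendsto (fun r : ℝ => f r * g r - f (-r) * g (-r)) atTop (𝓝 0) := by
    simpa using (hfg htop).sub ((hfg hbot).comp tendsto_neg_atTop_atBot)
  exact tendsto_nhds_unique hlim (hlim'.congr fun r => (hparts r).symm)

/-- The Gaussian Stein identity, for the unnormalized Gaussian density. -/
theorem gaussian_stein_identity {f f' : ℝ → ℝ} (hf' : Measurable f')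
    (hAC : ∀ x y : ℝ, f x - f y = ∫ t in y..x, f' t)
    {M M' : ℝ} (hfb : ∀ x, |f x| ≤ M) (hf'b : ∀ x, |f' x| ≤ M') (m : ℝ) {v : ℝ} (hv : 0 < v) :
    Integrable (fun x => (f' x - (x - m) / v * f x) * Real.exp (-(x - m) ^ 2 / (2 * v))) ∧
      ∫ x, (f' x - (x - m) / v * f x) * Real.exp (-(x - m) ^ 2 / (2 * v)) = 0 := by
  have hv2 : 0 < 1 / (2 * v) := by positivity
  have hd : deriv (fun x => Real.exp (-(x - m) ^ 2 / (2 * v))) =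
      fun x => -((x - m) / v) * Real.exp (-(x - m) ^ 2 / (2 * v)) := by
    funext x
    have h := (((((hasDerivAt_id x).sub_const m).pow 2).neg).div_const (2 * v)).exp.deriv
    refine h.trans ?_
    simp only [id, Pi.neg_apply, Pi.pow_apply]
    field_simp
    norm_num
    ring
  have hgi : Integrable fun x => Real.exp (-(x - m) ^ 2 / (2 * v)) := by
    convert (integrable_exp_neg_mul_sq hv2).comp_sub_right m using 3
    ring
  have hg'i : Integrable (deriv fun x => Real.exp (-(x - m) ^ 2 / (2 * v))) := by
    rw [hd]
    convert ((integrable_mul_exp_neg_mul_sq hv2).comp_sub_right m).const_mul (-1 / v) using 2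
    ring_nf
  have h := integral_deriv_mul_add_mul_deriv_eq_zero hf' hAC hfb hf'b
    (g := fun x => Real.exp (-(x - m) ^ 2 / (2 * v))) (by fun_prop) hgi hg'i
  have heq : (fun x => f' x * Real.exp (-(x - m) ^ 2 / (2 * v)) +
      f x * deriv (fun x => Real.exp (-(x - m) ^ 2 / (2 * v))) x) =
      fun x => (f' x - (x - m) / v * f x) * Real.exp (-(x - m) ^ 2 / (2 * v)) := by
    funext x
    rw [hd]
    ring
  rwa [heq] at h

/-- Completing the square in an exponentially tilted Gaussian density. -/
theorem exp_mul_gaussian (a b μ x : ℝ) {v : ℝ} (hv : v ≠ 0) :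
    Real.exp (a * x + b) * Real.exp (-(x - μ) ^ 2 / (2 * v)) =
      Real.exp (a * μ + b + a ^ 2 * v / 2) *
        Real.exp (-(x - (μ + a * v)) ^ 2 / (2 * v)) := by
  rw [← Real.exp_add, ← Real.exp_add]
  congr 1
  field_simp
  ring
/-- The Stein characterizing operator for the mixture Gaussian distribution
`M(a,b,μ,σ²)`: for any bounded absolutely continuous `f` with bounded
derivative, `E[f'(W) - ((W-μ)/σ² - a tanh(aW+b)) f(W)] = 0` when `W` has
density `ψ_{a,b,μ,σ²}`. -/
theorem stein_operator_mixture (a b μ v : ℝ) (hv : 0 < v)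
    (f f' : ℝ → ℝ) (hf' : Measurable f')
    (hAC : ∀ x y : ℝ, f x - f y = ∫ t in y..x, f' t)
    (M M' : ℝ) (hfb : ∀ x, |f x| ≤ M) (hf'b : ∀ x, |f' x| ≤ M') :
    ∫ x, (f' x - ((x - μ) / v - a * Real.tanh (a * x + b)) * f x)
        * mixDens a b μ v x = 0 := by
  obtain ⟨hi₁, h₁⟩ := gaussian_stein_identity hf' hAC hfb hf'b (μ + a * v) hv
  obtain ⟨hi₂, h₂⟩ := gaussian_stein_identity hf' hAC hfb hf'b (μ + -a * v) hv
  set Z := Real.sqrt (2 * π) * Real.sqrt v * Real.cosh (a * μ + b) * Real.exp (a ^ 2 * v / 2)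
    with hZ
  set c₁ := Real.exp (a * μ + b + a ^ 2 * v / 2) / (2 * Z) with hc₁
  set c₂ := Real.exp (-a * μ + -b + (-a) ^ 2 * v / 2) / (2 * Z) with hc₂
  have hsplit (x : ℝ) : (f' x - ((x - μ) / v - a * Real.tanh (a * x + b)) * f x)
        * mixDens a b μ v x =
      c₁ * ((f' x - (x - (μ + a * v)) / v * f x) *
        Real.exp (-(x - (μ + a * v)) ^ 2 / (2 * v))) +
      c₂ * ((f' x - (x - (μ + -a * v)) / v * f x) *
        Real.exp (-(x - (μ + -a * v)) ^ 2 / (2 * v))) := by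
    have e₁ := exp_mul_gaussian a b μ x hv.ne'
    have e₂ := exp_mul_gaussian (-a) (-b) μ x hv.ne'
    have hs₁ : (x - (μ + a * v)) / v = (x - μ) / v - a := by field_simp; ring
    have hs₂ : (x - (μ + -a * v)) / v = (x - μ) / v + a := by field_simp; ring
    have ht : Real.tanh (a * x + b) * Real.cosh (a * x + b) = Real.sinh (a * x + b) := by
      rw [Real.tanh_eq_sinh_div_cosh, div_mul_cancel₀ _ (Real.cosh_pos _).ne']
    have hneg : -a * x + -b = -(a * x + b) := by ring
    rw [hneg] at e₂
    rw [mixDens, ← hZ, hs₁, hs₂]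
    calc _ = ((f' x - (x - μ) / v * f x) * Real.cosh (a * x + b) +
            a * f x * (Real.tanh (a * x + b) * Real.cosh (a * x + b))) *
            Real.exp (-(x - μ) ^ 2 / (2 * v)) / Z := by ring
      _ = (f' x - ((x - μ) / v - a) * f x) *
            (Real.exp (a * x + b) * Real.exp (-(x - μ) ^ 2 / (2 * v))) / (2 * Z) +
          (f' x - ((x - μ) / v + a) * f x) *
            (Real.exp (-(a * x + b)) * Real.exp (-(x - μ) ^ 2 / (2 * v))) / (2 * Z) := by
        rw [ht, Real.cosh_eq, Real.sinh_eq]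
        ring
      _ = _ := by
        rw [e₁, e₂, hc₁, hc₂]
        ring
  simp_rw [hsplit]
  rw [integral_add (hi₁.const_mul c₁) (hi₂.const_mul c₂), integral_const_mul, integral_const_mul,
    h₁, h₂, mul_zero, mul_zero, add_zero]

end SK
end
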